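/- Let W be a weight function on the unit simplex T² = {(u,v) ∈ ℝ² : u ≥ 0, v ≥ 0, u + v ≤ 1} such that W^B(x,y) = W(x²,y²) is a weight function on the unit disk B² = {(x,y) : x² + y² ≤ 1}, and let {Sₙ} be the MOPS of W^B on B². Suppose that for each n ≥ 0 and 0 ≤ k ≤ n there is a real bivariate polynomial q_{n,k} with S_{2n+2,2k+1}(x,y) = x·y·q_{n,k}(x²,y²) for all (x,y). Then each q_{n,k} is monic with q_{n,k}(u,v) = u^{n−k} v^k + (terms of total degree < n), and the vectors Q̂ₙ = (q_{n,0},…,q_{n,n})ᵀ form the MOPS on T² of the weight √(uv)·W(u,v): ∫_{T²} Q̂ₙ(u,v) Q̂ₘ(u,v)ᵀ √(uv)·W(u,v) du dv = 0 whenever n ≠ m. -/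

import Mathlib

noncomputable section

open MeasureTheory MvPolynomial

/-- Evaluation of a bivariate polynomial at a point of `ℝ × ℝ`. -/
def ev (p : ℝ × ℝ) (f : MvPolynomial (Fin 2) ℝ) : ℝ := eval ![p.1, p.2] f

/-- `W` is a weight function on the measurable set `Ω ⊆ ℝ²`: nonnegative and measurable,
positive on a set of positive Lebesgue measure, with all moments finite. -/
def IsWeight (Ω : Set (ℝ × ℝ)) (W : ℝ × ℝ → ℝ) : Prop :=
  MeasurableSet Ω ∧ Measurable W ∧ (∀ p ∈ Ω, 0 ≤ W p) ∧
    0 < volume {p | p ∈ Ω ∧ 0 < W p} ∧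
    ∀ h k : ℕ, IntegrableOn (fun p : ℝ × ℝ => p.1 ^ h * p.2 ^ k * W p) Ω

/-- `W` is an `xy`-symmetric weight on `Ω`: `Ω` is invariant under `(x,y) ↦ (-x,y)` and
`(x,y) ↦ (x,-y)`, and `W(-x,y) = W(x,y) = W(x,-y)` on `Ω`. -/
def XYSymmetric (Ω : Set (ℝ × ℝ)) (W : ℝ × ℝ → ℝ) : Prop :=
  (∀ p : ℝ × ℝ, p ∈ Ω → (-p.1, p.2) ∈ Ω ∧ (p.1, -p.2) ∈ Ω) ∧
    ∀ p ∈ Ω, W (-p.1, p.2) = W p ∧ W (p.1, -p.2) = W p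

/-- `f` is monic of the form `x^(n-j) y^j + (terms of total degree < n)`. -/
def MonicLead (n j : ℕ) (f : MvPolynomial (Fin 2) ℝ) : Prop :=
  f = X 0 ^ (n - j) * X 1 ^ j ∨ (f - X 0 ^ (n - j) * X 1 ^ j).totalDegree < n

/-- `P` is the monic orthogonal polynomial system (MOPS) of the weight `W` on `Ω`:
each `P n j` is monic with leading term `x^(n-j) y^j`, and vectors of different degrees
are mutually orthogonal. -/
def IsMOPS (Ω : Set (ℝ × ℝ)) (W : ℝ × ℝ → ℝ)
    (P : (n : ℕ) → Fin (n + 1) → MvPolynomial (Fin 2) ℝ) : Prop :=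
  (∀ (n : ℕ) (j : Fin (n + 1)), MonicLead n (j : ℕ) (P n j)) ∧
    ∀ m n : ℕ, m ≠ n → ∀ (i : Fin (m + 1)) (j : Fin (n + 1)),
      ∫ p in Ω, ev p (P m i) * ev p (P n j) * W p = 0

/-- The image domain `Ω* = {(u,v) : u ≥ 0, v ≥ 0, (√u, √v) ∈ Ω}`. -/
def Ωstar (Ω : Set (ℝ × ℝ)) : Set (ℝ × ℝ) :=
  {q | 0 ≤ q.1 ∧ 0 ≤ q.2 ∧ (Real.sqrt q.1, Real.sqrt q.2) ∈ Ω}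

/-- The weight `W^(0,0)(u,v) = (1/4) (uv)^(-1/2) W(√u, √v)` on `Ω*`. -/
def W00 (W : ℝ × ℝ → ℝ) : ℝ × ℝ → ℝ :=
  fun q => (1 / 4) * W (Real.sqrt q.1, Real.sqrt q.2) / Real.sqrt (q.1 * q.2)

/-- The unit simplex `T² = {(u,v) : u, v ≥ 0, u + v ≤ 1}`. -/
def simplexT2 : Set (ℝ × ℝ) := {q | 0 ≤ q.1 ∧ 0 ≤ q.2 ∧ q.1 + q.2 ≤ 1}

/-- The closed unit disk `B² = {(x,y) : x² + y² ≤ 1}`. -/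
def ballB2 : Set (ℝ × ℝ) := {p | p.1 ^ 2 + p.2 ^ 2 ≤ 1}

/-- A polynomial of the form `f = x y g(x², y²)`, as an identity of polynomials. -/
theorem eq_X_mul_X_mul_expand_of_eval {f g : MvPolynomial (Fin 2) ℝ}
    (h : ∀ x y : ℝ, eval ![x, y] f = x * y * eval ![x ^ 2, y ^ 2] g) :
    f = X 0 * X 1 * expand 2 g := by
  refine MvPolynomial.funext fun v => ?_
  have hv : v = ![v 0, v 1] := by ext i; fin_cases i <;> rfl
  have hv2 : v ^ 2 = ![v 0 ^ 2, v 1 ^ 2] := by ext i; fin_cases i <;> rfl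
  rw [map_mul, map_mul, eval_X, eval_X, eval_expand, hv2, ← h, ← hv]

/-- If `x y g(x², y²)` is monic with leading term `x^(2n+1-2k) y^(2k+1)`, then `g` is monic with
leading term `u^(n-k) v^k`. -/
theorem MonicLead.of_X_mul_X_mul_expand {n k : ℕ} (hk : k ≤ n) {g : MvPolynomial (Fin 2) ℝ}
    (h : MonicLead (2 * n + 2) (2 * k + 1) (X 0 * X 1 * expand 2 g)) : MonicLead n k g := by
  have hlead : (X 0 ^ (2 * n + 2 - (2 * k + 1)) * X 1 ^ (2 * k + 1) : MvPolynomial (Fin 2) ℝ) =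
      X 0 * X 1 * expand 2 (X 0 ^ (n - k) * X 1 ^ k) := by
    rw [show 2 * n + 2 - (2 * k + 1) = 2 * (n - k) + 1 by omega]
    simp only [map_mul, map_pow, expand_X]
    ring
  have hX (i : Fin 2) : (X i : MvPolynomial (Fin 2) ℝ) ≠ 0 := X_ne_zero i
  by_cases hg : g - X 0 ^ (n - k) * X 1 ^ k = 0
  · exact Or.inl (sub_eq_zero.mp hg)
  have hexp := (expand_ne_zero (p := 2) two_pos).mpr hg
  rw [MonicLead, hlead, ← sub_eq_zero, ← mul_sub, ← map_sub] at h
  rcases h with h | h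
  · exact absurd h (mul_ne_zero (mul_ne_zero (hX 0) (hX 1)) hexp)
  · rw [totalDegree_mul_of_isDomain (mul_ne_zero (hX 0) (hX 1)) hexp,
      totalDegree_mul_of_isDomain (hX 0) (hX 1), totalDegree_X, totalDegree_X,
      totalDegree_expand] at h
    exact Or.inr (by omega)

/-- Polynomials are integrable against a weight function. -/
theorem IsWeight.integrableOn_ev_mul {Ω : Set (ℝ × ℝ)} {W : ℝ × ℝ → ℝ} (hW : IsWeight Ω W)
    (f : MvPolynomial (Fin 2) ℝ) : IntegrableOn (fun p => ev p f * W p) Ω := by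
  have hsum : (fun p => ev p f * W p) = fun p : ℝ × ℝ =>
      ∑ d ∈ f.support, coeff d f * (p.1 ^ d 0 * p.2 ^ d 1 * W p) := by
    ext p
    rw [ev, eval_eq', Finset.sum_mul]
    refine Finset.sum_congr rfl fun d _ => ?_
    simp only [Fin.prod_univ_two, Matrix.cons_val_zero, Matrix.cons_val_one]
    ring
  rw [hsum]
  exact integrable_finsetSum _ fun d _ => (hW.2.2.2.2 (d 0) (d 1)).const_mul _

/-- The integral of a function of `(|x|, |y|)` is four times that over the open first quadrant. -/
theorem integral_comp_abs_abs {f : ℝ × ℝ → ℝ}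
    (hf : Integrable fun p : ℝ × ℝ => f (|p.1|, |p.2|)) :
    ∫ p : ℝ × ℝ, f (|p.1|, |p.2|) = 4 * ∫ p in Set.Ioi 0 ×ˢ Set.Ioi 0, f p := by
  have hmeas : MeasurableSet (Set.Ioi (0 : ℝ) ×ˢ Set.Ioi (0 : ℝ)) :=
    measurableSet_Ioi.prod measurableSet_Ioi
  have hfQ : IntegrableOn f (Set.Ioi 0 ×ˢ Set.Ioi 0) := by
    refine (integrableOn_congr_fun (fun p hp => ?_) hmeas).mp hf.integrableOn
    simp only [abs_of_pos (Set.mem_Ioi.mp hp.1), abs_of_pos (Set.mem_Ioi.mp hp.2)]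
  rw [Measure.volume_eq_prod] at hf hfQ ⊢
  rw [integral_prod _ hf, setIntegral_prod _ hfQ]
  simp only [fun x : ℝ => integral_comp_abs (f := fun y => f (|x|, y))]
  rw [integral_comp_abs (f := fun x => 2 * ∫ y in Set.Ioi (0 : ℝ), f (x, y)),
    integral_const_mul]
  ring

/-- The change of variables `(u, v) = (x², y²)` on the open first quadrant. -/
theorem setIntegral_Ioi_prod_Ioi_comp_sq (F : ℝ × ℝ → ℝ) :
    ∫ p in Set.Ioi 0 ×ˢ Set.Ioi 0, F p =
      ∫ p in Set.Ioi 0 ×ˢ Set.Ioi 0, 4 * (p.1 * p.2) * F (p.1 ^ 2, p.2 ^ 2) := by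
  set φ : ℝ × ℝ → ℝ × ℝ := fun p => (p.1 ^ 2, p.2 ^ 2)
  let φ' : ℝ × ℝ → (ℝ × ℝ →L[ℝ] ℝ × ℝ) := fun p =>
    ((2 * p.1) • ContinuousLinearMap.id ℝ ℝ).prodMap ((2 * p.2) • ContinuousLinearMap.id ℝ ℝ)
  have hmeas : MeasurableSet (Set.Ioi (0 : ℝ) ×ˢ Set.Ioi (0 : ℝ)) :=
    measurableSet_Ioi.prod measurableSet_Ioi
  have himage : φ '' (Set.Ioi 0 ×ˢ Set.Ioi 0) = Set.Ioi 0 ×ˢ Set.Ioi 0 := by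
    ext p
    constructor
    · rintro ⟨z, ⟨hz1, hz2⟩, rfl⟩
      exact ⟨Set.mem_Ioi.mpr (pow_pos hz1 2), Set.mem_Ioi.mpr (pow_pos hz2 2)⟩
    · rintro ⟨h1, h2⟩
      exact ⟨(√p.1, √p.2), ⟨Real.sqrt_pos.mpr h1, Real.sqrt_pos.mpr h2⟩,
        Prod.ext (Real.sq_sqrt (le_of_lt h1)) (Real.sq_sqrt (le_of_lt h2))⟩
  have hinj : Set.InjOn φ (Set.Ioi 0 ×ˢ Set.Ioi 0) := by
    rintro a ⟨ha1, ha2⟩ b ⟨hb1, hb2⟩ hab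
    exact Prod.ext
      ((pow_left_inj₀ (le_of_lt ha1) (le_of_lt hb1) two_ne_zero).mp (congrArg Prod.fst hab))
      ((pow_left_inj₀ (le_of_lt ha2) (le_of_lt hb2) two_ne_zero).mp (congrArg Prod.snd hab))
  have hderiv (p : ℝ × ℝ) : HasFDerivAt φ (φ' p) p := by
    have h (t : ℝ) : HasFDerivAt (fun s : ℝ => s ^ 2)
        ((2 * t) • ContinuousLinearMap.id ℝ ℝ) t := by
      refine (hasDerivAt_pow 2 t).hasFDerivAt.congr_fderiv ?_
      ext
      simp
    exact HasFDerivAt.prodMap p (h p.1) (h p.2)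
  have hdet (p : ℝ × ℝ) : (φ' p).det = 4 * (p.1 * p.2) := by
    have : ((φ' p : ℝ × ℝ →L[ℝ] ℝ × ℝ) : ℝ × ℝ →ₗ[ℝ] ℝ × ℝ) =
        ((2 * p.1) • LinearMap.id).prodMap ((2 * p.2) • LinearMap.id) := rfl
    rw [ContinuousLinearMap.det, this, LinearMap.det_prodMap]
    simp only [LinearMap.det_smul, Module.finrank_self, LinearMap.det_id]
    ring
  conv_lhs => rw [← himage]
  rw [integral_image_eq_integral_abs_det_fderiv_smul volume hmeas
    (fun p _ => (hderiv p).hasFDerivWithinAt) hinj]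
  refine setIntegral_congr_fun hmeas fun p hp => ?_
  have hpos : 0 < 4 * (p.1 * p.2) := mul_pos four_pos (mul_pos hp.1 hp.2)
  simp only [hdet, abs_of_pos hpos, smul_eq_mul, φ]

theorem measurableSet_simplexT2 : MeasurableSet simplexT2 :=
  (measurableSet_le measurable_const measurable_fst).inter
    ((measurableSet_le measurable_const measurable_snd).inter
      (measurableSet_le (measurable_fst.add measurable_snd) measurable_const))

theorem measurableSet_ballB2 : MeasurableSet ballB2 :=
  measurableSet_le ((measurable_fst.pow_const 2).add (measurable_snd.pow_const 2))
    measurable_const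

theorem sq_mem_simplexT2_iff {x y : ℝ} : (x ^ 2, y ^ 2) ∈ simplexT2 ↔ (x, y) ∈ ballB2 :=
  ⟨fun h => h.2.2, fun h => ⟨sq_nonneg x, sq_nonneg y, h⟩⟩

/-- Integrals over the simplex against `√(uv)` are integrals over the disk against `x² y²`. -/
theorem setIntegral_simplexT2_sqrt_mul (F : ℝ × ℝ → ℝ)
    (hF : IntegrableOn (fun p => (p.1 * p.2) ^ 2 * F (p.1 ^ 2, p.2 ^ 2)) ballB2) :
    ∫ z in simplexT2, √(z.1 * z.2) * F z =
      ∫ p in ballB2, (p.1 * p.2) ^ 2 * F (p.1 ^ 2, p.2 ^ 2) := by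
  set G : ℝ × ℝ → ℝ := ballB2.indicator fun p => (p.1 * p.2) ^ 2 * F (p.1 ^ 2, p.2 ^ 2)
  have hG : (fun p : ℝ × ℝ => G (|p.1|, |p.2|)) = G := by
    ext p
    simp only [G, Set.indicator, ballB2, Set.mem_ofPred_eq, sq_abs, mul_pow]
  have hGint : Integrable G := hF.integrable_indicator measurableSet_ballB2
  have hsub : simplexT2 ⊆ Set.Ici 0 ×ˢ Set.Ici 0 := fun z hz => ⟨hz.1, hz.2.1⟩
  have hae : (Set.Ici (0 : ℝ) ×ˢ Set.Ici (0 : ℝ) : Set (ℝ × ℝ)) =ᵐ[volume]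
      Set.Ioi (0 : ℝ) ×ˢ Set.Ioi (0 : ℝ) :=
    Measure.set_prod_ae_eq Ioi_ae_eq_Ici.symm Ioi_ae_eq_Ici.symm
  calc ∫ z in simplexT2, √(z.1 * z.2) * F z
      = ∫ z in Set.Ioi 0 ×ˢ Set.Ioi 0,
          simplexT2.indicator (fun z => √(z.1 * z.2) * F z) z := by
        rw [← setIntegral_congr_set hae, setIntegral_indicator measurableSet_simplexT2,
          Set.inter_eq_right.mpr hsub]
    _ = ∫ p in Set.Ioi 0 ×ˢ Set.Ioi 0, 4 * G p := by
        rw [setIntegral_Ioi_prod_Ioi_comp_sq]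
        refine setIntegral_congr_fun (measurableSet_Ioi.prod measurableSet_Ioi) fun p hp => ?_
        have hpos : 0 ≤ p.1 * p.2 := (mul_pos hp.1 hp.2).le
        by_cases hpB : p ∈ ballB2
        · simp only [G, Set.indicator_of_mem hpB,
            Set.indicator_of_mem (sq_mem_simplexT2_iff.mpr hpB), ← mul_pow, Real.sqrt_sq hpos]
          ring
        · simp only [G, Set.indicator_of_notMem hpB,
            Set.indicator_of_notMem (mt sq_mem_simplexT2_iff.mp hpB), mul_zero]
    _ = ∫ p in ballB2, (p.1 * p.2) ^ 2 * F (p.1 ^ 2, p.2 ^ 2) := by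
        rw [integral_const_mul, ← integral_comp_abs_abs (by rwa [hG]), hG,
          integral_indicator measurableSet_ballB2]

/-- Ball–simplex case study: let `W` be a weight on the simplex `T²` such that
`W^B(x,y) = W(x²,y²)` is a weight on the disk `B²`, and let `{Sₙ}` be the MOPS of
`W^B` on `B²`.  If `S_{2n+2,2k+1}(x,y) = x y q_{n,k}(x²,y²)`, then the `q_{n,k}`
are monic with leading term `u^(n-k) v^k` and the vectors `(q_{n,0},…,q_{n,n})ᵀ`
form the MOPS of the weight `√(uv) W(u,v)` on `T²`. -/
theorem stmt19 (W : ℝ × ℝ → ℝ) (hW : IsWeight simplexT2 W)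
    (hWB : IsWeight ballB2 (fun p => W (p.1 ^ 2, p.2 ^ 2)))
    (S : (n : ℕ) → Fin (n + 1) → MvPolynomial (Fin 2) ℝ)
    (hS : IsMOPS ballB2 (fun p => W (p.1 ^ 2, p.2 ^ 2)) S)
    (q : (n : ℕ) → Fin (n + 1) → MvPolynomial (Fin 2) ℝ)
    (hrel : ∀ (n : ℕ) (k : Fin (n + 1)) (x y : ℝ),
      eval ![x, y] (S (2 * n + 2) ⟨2 * (k : ℕ) + 1, by have := k.isLt; omega⟩) =
        x * y * eval ![x ^ 2, y ^ 2] (q n k)) :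
    IsMOPS simplexT2 (fun z => Real.sqrt (z.1 * z.2) * W z) q := by
  refine ⟨fun n k => ?_, fun m n hmn i j => ?_⟩
  · have hlead := hS.1 (2 * n + 2) ⟨2 * (k : ℕ) + 1, by have := k.isLt; omega⟩
    rw [eq_X_mul_X_mul_expand_of_eval (hrel n k)] at hlead
    exact hlead.of_X_mul_X_mul_expand (Nat.lt_succ_iff.mp k.isLt)
  · set A := S (2 * m + 2) ⟨2 * (i : ℕ) + 1, by have := i.isLt; omega⟩ with hA
    set B := S (2 * n + 2) ⟨2 * (j : ℕ) + 1, by have := j.isLt; omega⟩ with hB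
    have hprod (p : ℝ × ℝ) : (p.1 * p.2) ^ 2 * (ev (p.1 ^ 2, p.2 ^ 2) (q m i) *
        ev (p.1 ^ 2, p.2 ^ 2) (q n j) * W (p.1 ^ 2, p.2 ^ 2)) =
        ev p A * ev p B * W (p.1 ^ 2, p.2 ^ 2) := by
      simp only [ev, hA, hB, hrel]
      ring
    have hint : IntegrableOn (fun p => ev p A * ev p B * W (p.1 ^ 2, p.2 ^ 2)) ballB2 := by
      simpa only [ev, map_mul] using hWB.integrableOn_ev_mul (A * B)
    have key := setIntegral_simplexT2_sqrt_mul
      (fun z => ev z (q m i) * ev z (q n j) * W z) (by simpa only [hprod] using hint)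
    simp only [hprod] at key
    rw [hS.2 _ _ (by omega)] at key
    rw [← key]
    exact integral_congr_ae (Filter.Eventually.of_forall fun z => by ring)
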